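/- Let H be a finite abelian group, let n be a positive integer with exp(H) ∣ n, and let G' = C_n ⊕ H. Then η(G') ≥ 2·(D(H) − 1) + n. -/

import Mathlib

/-- The zero-sum invariant `s_L(G)`: the smallest positive integer `ℓ` such that every
sequence (multiset) over `G` of length at least `ℓ` contains a nonempty zero-sum
subsequence whose length lies in `L`. -/
noncomputable def zsInv (G : Type*) [AddCommGroup G] (L : Set ℕ) : ℕ :=
  sInf {ℓ : ℕ | 0 < ℓ ∧ ∀ S : Multiset G, ℓ ≤ Multiset.card S →
    ∃ T : Multiset G, T ≤ S ∧ T ≠ 0 ∧ T.sum = 0 ∧ Multiset.card T ∈ L}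

/-- The Davenport constant `D(G)`. -/
noncomputable def davenport (G : Type*) [AddCommGroup G] : ℕ := zsInv G {t | 0 < t}

/-- The η-invariant `η(G) = s_{[1, exp(G)]}(G)`. -/
noncomputable def etaInv (G : Type*) [AddCommGroup G] : ℕ :=
  zsInv G {t | 0 < t ∧ t ≤ AddMonoid.exponent G}

/-- The Erdős–Ginzburg–Ziv constant `s(G) = s_{{exp(G)}}(G)`. -/
noncomputable def egzConst (G : Type*) [AddCommGroup G] : ℕ :=
  zsInv G {AddMonoid.exponent G}

/-- `η_i(G) = s_{[i, exp(G)]}(G)`. -/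
noncomputable def etaI (G : Type*) [AddCommGroup G] (i : ℕ) : ℕ :=
  zsInv G {t | i ≤ t ∧ t ≤ AddMonoid.exponent G}

/-- `ζ_i(G) = s_{[i-n,0] + nℕ⁺}(G)` where `n = exp(G)`: the invariant for zero-sum
subsequences whose length is congruent mod `n` to some residue `r` with `i ≤ r ≤ n`. -/
noncomputable def zetaI (G : Type*) [AddCommGroup G] (i : ℕ) : ℕ :=
  zsInv G {t | 0 < t ∧ ∃ r : ℕ, i ≤ r ∧ r ≤ AddMonoid.exponent G ∧
    t % AddMonoid.exponent G = r % AddMonoid.exponent G}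

theorem zsInv_exponent_set_nonempty (G : Type*) [AddCommGroup G] [Finite G] :
    {ℓ : ℕ | 0 < ℓ ∧ ∀ S : Multiset G, ℓ ≤ Multiset.card S → ∃ T : Multiset G, T ≤ S ∧ T ≠ 0 ∧
      T.sum = 0 ∧ Multiset.card T ∈ {t | 0 < t ∧ t ≤ AddMonoid.exponent G}}.Nonempty := by
  classical
  have := Fintype.ofFinite G
  set e := AddMonoid.exponent G with he
  have he0 : 0 < e := AddMonoid.ExponentExists.exponent_pos AddMonoid.ExponentExists.of_finite
  refine ⟨Fintype.card G * e, Nat.mul_pos Fintype.card_pos he0, fun S hS => ?_⟩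
  obtain ⟨g, -, hg⟩ : ∃ g ∈ (Finset.univ : Finset G), e ≤ S.count g := by
    refine Finset.exists_le_of_sum_le Finset.univ_nonempty ?_
    rw [Multiset.sum_count_eq_card fun a _ => Finset.mem_univ a]
    simpa using hS
  refine ⟨Multiset.replicate e g, Multiset.le_count_iff_replicate_le.mp hg, ?_, ?_, ?_⟩
  · rw [← Multiset.card_pos]
    simpa using he0
  · rw [Multiset.sum_replicate, AddMonoid.exponent_nsmul_eq_zero]
  · simpa using he0

theorem exists_zeroSumFree_card_eq (H : Type*) [AddCommGroup H] :
    ∃ T : Multiset H, Multiset.card T = davenport H - 1 ∧ ∀ U ≤ T, U.sum = 0 → U = 0 := by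
  rcases Nat.eq_zero_or_pos (davenport H - 1) with h0 | h0
  · exact ⟨0, by simp [h0], fun U hU _ => Multiset.le_zero.mp hU⟩
  have hlt : davenport H - 1 < davenport H := by omega
  have hnot := Nat.notMem_of_lt_sInf hlt
  simp only [Set.mem_ofPred_eq, not_and, not_forall] at hnot
  obtain ⟨S, hS, hfree⟩ := hnot h0
  obtain ⟨T, hT⟩ : ∃ T, T ∈ Multiset.powersetCard (davenport H - 1) S := by
    rw [← Multiset.card_pos_iff_exists_mem, Multiset.card_powersetCard]
    exact Nat.choose_pos hS
  obtain ⟨hT, hcard⟩ := Multiset.mem_powersetCard.mp hT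
  refine ⟨T, hcard, fun U hU hsum => ?_⟩
  by_contra hne
  exact hfree ⟨U, hU.trans hT, hne, hsum, Multiset.card_pos.mpr hne⟩

theorem Multiset.exists_add_of_le_add {α : Type*} {U X Y : Multiset α} (h : U ≤ X + Y) :
    ∃ A B, A ≤ X ∧ B ≤ Y ∧ U = A + B := by
  classical
  refine ⟨U ∩ X, U - X, Multiset.inter_le_right, Multiset.sub_le_iff_le_add'.mpr h, ?_⟩
  ext a
  simp only [Multiset.count_add, Multiset.count_inter, Multiset.count_sub]
  omega

theorem Multiset.map_snd_le_and_sum_map_fst {α β : Type*} [AddCommMonoid α] {a : α}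
    {T : Multiset β} {U : Multiset (α × β)} (h : U ≤ T.map (Prod.mk a)) :
    U.map Prod.snd ≤ T ∧ (U.map Prod.fst).sum = Multiset.card U • a := by
  constructor
  · simpa [Multiset.map_map, Function.comp_def] using Multiset.map_le_map (f := Prod.snd) h
  · rw [Multiset.map_congr rfl (g := fun _ => a), Multiset.map_const', Multiset.sum_replicate]
    intro x hx
    obtain ⟨y, -, rfl⟩ := Multiset.mem_map.mp (Multiset.mem_of_le h hx)
    rfl

/-- Extending a zero-sum free sequence over `H` to a sequence over `C_n ⊕ H` without short
zero-sum subsequences. -/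
theorem eq_zero_of_le_of_sum_eq_zero_of_card_le {H : Type*} [AddCommGroup H] {n : ℕ} (hn : 0 < n)
    {T : Multiset H} (hT : ∀ U ≤ T, U.sum = 0 → U = 0) {U : Multiset (ZMod n × H)}
    (hU : U ≤ T.map (Prod.mk 0) + (T.map (Prod.mk 1) +
      (Multiset.replicate (n - 1) (0 : H)).map (Prod.mk 1)))
    (hsum : U.sum = 0) (hcard : Multiset.card U ≤ n) : U = 0 := by
  obtain ⟨A, V, hA, hV, rfl⟩ := Multiset.exists_add_of_le_add hU
  obtain ⟨B, C, hB, hC, rfl⟩ := Multiset.exists_add_of_le_add hV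
  obtain ⟨hA₂, hA₁⟩ := Multiset.map_snd_le_and_sum_map_fst hA
  obtain ⟨hB₂, hB₁⟩ := Multiset.map_snd_le_and_sum_map_fst hB
  obtain ⟨hC₂, hC₁⟩ := Multiset.map_snd_le_and_sum_map_fst hC
  have hCcard : Multiset.card C ≤ n - 1 := by simpa using Multiset.card_le_card hC₂
  have hCsum : (C.map Prod.snd).sum = 0 := by
    obtain ⟨k, -, hk⟩ := Multiset.le_replicate_iff.mp hC₂
    simp [hk]
  have h₁ : ((A + (B + C)).map Prod.fst).sum = 0 := by
    rw [← AddMonoidHom.coe_fst, ← map_multiset_sum, hsum, map_zero]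
  have h₂ : ((A + (B + C)).map Prod.snd).sum = 0 := by
    rw [← AddMonoidHom.coe_snd, ← map_multiset_sum, hsum, map_zero]
  simp only [Multiset.map_add, Multiset.sum_add, hA₁, hB₁, hC₁, hCsum, smul_zero, zero_add,
    add_zero] at h₁ h₂
  have hdvd : n ∣ Multiset.card B + Multiset.card C := by
    rw [← ZMod.natCast_eq_zero_iff]
    simpa using h₁
  simp only [Multiset.card_add] at hcard
  rcases Nat.eq_zero_or_pos (Multiset.card B + Multiset.card C) with h0 | hpos
  · obtain rfl : B = 0 := Multiset.card_eq_zero.mp (by omega)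
    obtain rfl : C = 0 := Multiset.card_eq_zero.mp (by omega)
    simpa using hT _ hA₂ (by simpa using h₂)
  · have hle := Nat.le_of_dvd hpos hdvd
    obtain rfl : A = 0 := Multiset.card_eq_zero.mp (by omega)
    have hB0 : B = 0 := by simpa using hT _ hB₂ (by simpa using h₂)
    simp only [hB0, Multiset.card_zero] at hle
    omega

/-- Let `H` be a finite abelian group and `n` a positive integer with
`exp(H) ∣ n`, and let `G' = C_n ⊕ H`. Then `η(G') ≥ 2·(D(H) − 1) + n`. -/
theorem stmt16 (H : Type*) [AddCommGroup H] [Finite H]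
    (n : ℕ) (hn : 0 < n) (hdvd : AddMonoid.exponent H ∣ n) :
    2 * (davenport H - 1) + n ≤ etaInv (ZMod n × H) := by
  have : NeZero n := ⟨hn.ne'⟩
  have hexp : AddMonoid.exponent (ZMod n × H) = n := by
    rw [AddMonoid.exponent_prod, ZMod.exponent]
    exact Nat.lcm_eq_left hdvd
  obtain ⟨T, hcard, hT⟩ := exists_zeroSumFree_card_eq H
  refine le_csInf (zsInv_exponent_set_nonempty (ZMod n × H)) fun ℓ hℓ => ?_
  by_contra! hlt
  obtain ⟨U, hU, hne, hsum, -, hle⟩ := hℓ.2 (T.map (Prod.mk 0) + (T.map (Prod.mk 1) +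
    (Multiset.replicate (n - 1) (0 : H)).map (Prod.mk 1))) (by
      simp only [Multiset.card_add, Multiset.card_map, Multiset.card_replicate, hcard]
      omega)
  exact hne (eq_zero_of_le_of_sum_eq_zero_of_card_le hn hT hU hsum (hle.trans_eq hexp))
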